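/- Assume n ≥ 3 and let D be a domain with D_C ⊊ D such that there is a profile R ∈ D in which for every alternative x there is an alternative y with g_R(y,x) > 0 (i.e., R has no weak Condorcet winner). Then an SDS on D is group-strategyproof and non-imposing if and only if it is a dictatorship d_i for some voter i. -/

import Mathlib

open scoped Classical
open Finset

/-- A preference relation: a complete, transitive, and antisymmetric binary relation. -/
def IsPref {A : Type*} (r : A → A → Prop) : Prop :=
  (∀ x y : A, x ≠ y → r x y ∨ r y x) ∧
  (∀ x y z : A, r x y → r y z → r x z) ∧
  (∀ x y : A, r x y → ¬ r y x)

/-- A preference profile for `n` voters over alternatives `A`. -/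
abbrev Prof (n : ℕ) (A : Type*) := Fin n → A → A → Prop

/-- Every voter's relation is a preference relation. -/
def IsProf {n : ℕ} {A : Type*} (R : Prof n A) : Prop := ∀ i, IsPref (R i)

/-- The majority margin `g_R(x,y)`. -/
noncomputable def margin {n : ℕ} {A : Type*} (R : Prof n A) (x y : A) : ℤ :=
  (Nat.card {i : Fin n // R i x y} : ℤ) - (Nat.card {i : Fin n // R i y x} : ℤ)

/-- `x` is the Condorcet winner of `R`. -/
def CondorcetWinner {n : ℕ} {A : Type*} (R : Prof n A) (x : A) : Prop :=
  ∀ y, y ≠ x → 0 < margin R x y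

/-- The Condorcet domain: all profiles admitting a Condorcet winner. -/
def CondorcetDomain (n : ℕ) (A : Type*) : Set (Prof n A) :=
  {R | IsProf R ∧ ∃ x, CondorcetWinner R x}

/-- The `(n+1)`-voter profile `(R, ▷)` obtained from `R` by adding `t` as an extra voter. -/
def tieProf {n : ℕ} {A : Type*} (R : Prof n A) (t : A → A → Prop) : Prof (n + 1) A :=
  Fin.cons t R

/-- The tie-breaking Condorcet domain `D_C^▷`. -/
def TieCondorcetDomain (n : ℕ) {A : Type*} (t : A → A → Prop) : Set (Prof n A) :=
  {R | IsProf R ∧ ∃ x, CondorcetWinner (tieProf R t) x}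

/-- Upper contour set `U(≻, x)`. -/
def UC {A : Type*} (r : A → A → Prop) (x : A) : Set A := {y | r y x ∨ y = x}

/-- Probability that the lottery `p` assigns to the set `S`. -/
noncomputable def mass {A : Type*} [Fintype A] (p : A → ℝ) (S : Set A) : ℝ :=
  ∑ y, S.indicator p y

/-- Stochastic dominance `p ≿^SD q` w.r.t. the preference relation `r`. -/
def SDdom {A : Type*} [Fintype A] (r : A → A → Prop) (p q : A → ℝ) : Prop :=
  ∀ x, mass q (UC r x) ≤ mass p (UC r x)

/-- `f` is a social decision scheme on the domain `D`: on `D` it returns lotteries. -/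
def IsSDS {n : ℕ} {A : Type*} [Fintype A] (D : Set (Prof n A))
    (f : Prof n A → A → ℝ) : Prop :=
  ∀ R ∈ D, (∀ x, 0 ≤ f R x) ∧ (∑ x, f R x) = 1

/-- Strategyproofness of `f` on `D`. -/
def Strategyproof {n : ℕ} {A : Type*} [Fintype A] (D : Set (Prof n A))
    (f : Prof n A → A → ℝ) : Prop :=
  ∀ R ∈ D, ∀ R' ∈ D, ∀ i : Fin n,
    (∀ j, j ≠ i → R j = R' j) → SDdom (R i) (f R) (f R')

/-- Group-strategyproofness of `f` on `D`. -/
def GroupStrategyproof {n : ℕ} {A : Type*} [Fintype A] (D : Set (Prof n A))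
    (f : Prof n A → A → ℝ) : Prop :=
  ∀ R ∈ D, ∀ R' ∈ D, ∀ I : Finset (Fin n), I.Nonempty →
    (∀ j ∉ I, R j = R' j) → ∃ i ∈ I, SDdom (R i) (f R) (f R')

/-- Non-imposition of `f` on `D`. -/
def NonImposing {n : ℕ} {A : Type*} [Fintype A] (D : Set (Prof n A))
    (f : Prof n A → A → ℝ) : Prop :=
  ∀ x : A, ∃ R ∈ D, f R x = 1

/-- Ex post efficiency of `f` on `D`. -/
def ExPostEfficient {n : ℕ} {A : Type*} [Fintype A] (D : Set (Prof n A))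
    (f : Prof n A → A → ℝ) : Prop :=
  ∀ R ∈ D, ∀ x y : A, (∀ i, R i x y) → f R y = 0

/-- `x` is top-ranked by the preference relation `r`. -/
def TopRanked {A : Type*} (r : A → A → Prop) (x : A) : Prop := ∀ y, y ≠ x → r x y

/-- The dictatorship of voter `i`. -/
noncomputable def dict {n : ℕ} {A : Type*} [Fintype A] (i : Fin n) (R : Prof n A) : A → ℝ :=
  fun x => if TopRanked (R i) x then 1 else 0

/-- The Condorcet rule `COND`. -/
noncomputable def CondRule {n : ℕ} {A : Type*} [Fintype A] : Prof n A → A → ℝ :=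
  fun R x => if CondorcetWinner R x then 1 else 0

/-- The tie-breaking Condorcet rule `COND^▷`. -/
noncomputable def TieCondRule {n : ℕ} {A : Type*} [Fintype A] (t : A → A → Prop) :
    Prof n A → A → ℝ :=
  fun R x => if CondorcetWinner (tieProf R t) x then 1 else 0

/-- The relation obtained from `r` by swapping the (adjacent) alternatives `x ≻ y`. -/
def swapRel {A : Type*} (r : A → A → Prop) (x y : A) : A → A → Prop :=
  fun a b => (a = y ∧ b = x) ∨ (r a b ∧ ¬(a = x ∧ b = y))

/-- `R'` arises from `R` by letting voter `i` swap the adjacent alternatives `x ≻_i y`,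
i.e., `R' = R^{i:yx}`. -/
def AdjSwap {n : ℕ} {A : Type*} (R R' : Prof n A) (i : Fin n) (x y : A) : Prop :=
  x ≠ y ∧ R i x y ∧ (∀ z, z ≠ x → z ≠ y → ¬(R i x z ∧ R i z y)) ∧
  R' i = swapRel (R i) x y ∧ (∀ j, j ≠ i → R' j = R j)

/-- A single ad-path step inside `D`. -/
def Step {n : ℕ} {A : Type*} (D : Set (Prof n A)) (R R' : Prof n A) : Prop :=
  R ∈ D ∧ R' ∈ D ∧ ∃ i x y, AdjSwap R R' i x y

/-- A single ad-path step inside `D` in which the alternative `a` is not swapped. -/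
def StepAvoiding {n : ℕ} {A : Type*} (D : Set (Prof n A)) (a : A) (R R' : Prof n A) : Prop :=
  R ∈ D ∧ R' ∈ D ∧ ∃ i x y, AdjSwap R R' i x y ∧ x ≠ a ∧ y ≠ a

/-- There is an ad-path from `R` to `R'` inside `D`. -/
def AdPath {n : ℕ} {A : Type*} (D : Set (Prof n A)) (R R' : Prof n A) : Prop :=
  R ∈ D ∧ R' ∈ D ∧ Relation.ReflTransGen (Step D) R R'

/-- There is an ad-path from `R` to `R'` inside `D` along which `a` is never swapped. -/
def AdPathAvoiding {n : ℕ} {A : Type*} (D : Set (Prof n A)) (a : A) (R R' : Prof n A) : Prop :=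
  R ∈ D ∧ R' ∈ D ∧ Relation.ReflTransGen (StepAvoiding D a) R R'

/-- `D` is weakly connected. -/
def WeaklyConnected {n : ℕ} {A : Type*} (D : Set (Prof n A)) : Prop :=
  ∀ R ∈ D, ∀ R' ∈ D, AdPath D R R'

/-- `D` is connected. -/
def Connected {n : ℕ} {A : Type*} (D : Set (Prof n A)) : Prop :=
  WeaklyConnected D ∧
  ∀ a : A, ∀ R ∈ D, ∀ R' ∈ D, (∀ i, UC (R i) a = UC (R' i) a) → AdPathAvoiding D a R R'

theorem exists_ranked_pref {A : Type*} [Fintype A] {a b c : A} (hab : a ≠ b) (hac : a ≠ c)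
    (hbc : b ≠ c) : ∃ r : A → A → Prop, IsPref r ∧ TopRanked r a ∧
      (∀ x, x ≠ a → x ≠ b → r b x) ∧ (∀ x, x ≠ c → r x c) := by
  obtain ⟨e⟩ := Fintype.truncEquivFin A |>.nonempty
  let k : A → ℕ := fun x =>
    if x = a then 0 else if x = b then 1 else if x = c then Fintype.card A + 3 else 2 + (e x : ℕ)
  have hk : Function.Injective k := by
    intro x y h
    have hx := (e x).isLt
    have hy := (e y).isLt
    simp only [k] at h
    split_ifs at h <;> first | omega | (subst_vars; rfl) | skip
    exact e.injective (Fin.ext (by omega))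
  refine ⟨fun x y => k x < k y, ⟨?_, ?_, ?_⟩, ?_, ?_, ?_⟩
  · intro x y hxy
    exact lt_or_gt_of_ne (hk.ne hxy)
  · intro x y z
    exact lt_trans
  · intro x y
    exact lt_asymm
  · intro x hx
    simp only [k, if_pos rfl, if_neg hx]
    split_ifs <;> omega
  · intro x hxa hxb
    simp only [k, if_neg hxa, if_neg hxb, if_neg hab.symm]
    split_ifs <;> omega
  · intro x hx
    have := (e x).isLt
    simp only [k, if_neg hx, if_neg hac.symm, if_neg hbc.symm]
    split_ifs <;> omega

theorem exists_third {A : Type*} [Fintype A] (hA : 3 ≤ Fintype.card A) (a b : A) :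
    ∃ c, c ≠ a ∧ c ≠ b := by
  by_contra! h
  have hsub : (Finset.univ : Finset A) ⊆ {a, b} := by
    intro c _
    by_cases hc : c = a
    · simp [hc]
    · simp [h c hc]
  have h1 := Finset.card_le_card hsub
  have h2 := Finset.card_le_two (a := a) (b := b)
  rw [Finset.card_univ] at h1
  omega

theorem exists_pref_topRanked {A : Type*} [Fintype A] (hA : 3 ≤ Fintype.card A) (a : A) :
    ∃ r : A → A → Prop, IsPref r ∧ TopRanked r a := by
  obtain ⟨b, hb, -⟩ := exists_third hA a a
  obtain ⟨c, hca, hcb⟩ := exists_third hA a b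
  obtain ⟨r, hr, hra, -⟩ := exists_ranked_pref hb.symm hca.symm hcb.symm
  exact ⟨r, hr, hra⟩

theorem IsPref.irrefl {A : Type*} {r : A → A → Prop} (hr : IsPref r) (x : A) : ¬ r x x :=
  fun h => hr.2.2 x x h h

theorem IsPref.exists_topRanked {A : Type*} [Finite A] [Nonempty A] {r : A → A → Prop}
    (hr : IsPref r) : ∃ a, TopRanked r a := by
  have : IsTrans A r := ⟨hr.2.1⟩
  have : Std.Irrefl r := ⟨hr.irrefl⟩
  obtain ⟨a, -, ha⟩ := (Finite.wellFounded_of_trans_of_irrefl r).has_min Set.univ Set.univ_nonempty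
  exact ⟨a, fun y hy => (hr.1 a y hy.symm).resolve_right (ha y trivial)⟩

/-- `p` is a probability distribution on `A`. -/
def IsLottery {A : Type*} [Fintype A] (p : A → ℝ) : Prop :=
  (∀ x, 0 ≤ p x) ∧ ∑ x, p x = 1

namespace IsLottery

variable {A : Type*} [Fintype A] {p : A → ℝ}

theorem add_le_one (hp : IsLottery p) {a b : A} (hab : a ≠ b) : p a + p b ≤ 1 := by
  rw [← hp.2, ← Finset.sum_pair hab]
  exact Finset.sum_le_sum_of_subset_of_nonneg (Finset.subset_univ _) fun x _ _ => hp.1 x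

theorem le_one (hp : IsLottery p) (a : A) : p a ≤ 1 := by
  rw [← hp.2]
  exact Finset.single_le_sum (fun x _ => hp.1 x) (Finset.mem_univ a)

theorem eq_zero_of_eq_one (hp : IsLottery p) {a b : A} (ha : p a = 1) (hba : b ≠ a) :
    p b = 0 := by
  have := hp.add_le_one hba
  have := hp.1 b
  linarith

theorem eq_one_of_forall (hp : IsLottery p) {a : A} (h : ∀ x, x ≠ a → p x = 0) : p a = 1 := by
  rw [← hp.2, Finset.sum_eq_single a (fun x _ hx => h x hx) (fun h => absurd (Finset.mem_univ a) h)]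

theorem mass_le_one (hp : IsLottery p) (S : Set A) : mass p S ≤ 1 := by
  rw [← hp.2]
  exact Finset.sum_le_sum fun x _ => Set.indicator_le_self' (fun _ _ => hp.1 x) x

theorem le_mass (hp : IsLottery p) {S : Set A} {a : A} (ha : a ∈ S) : p a ≤ mass p S := by
  have h := Finset.single_le_sum (s := Finset.univ) (f := S.indicator p)
    (fun x _ => Set.indicator_nonneg (fun y _ => hp.1 y) x) (Finset.mem_univ a)
  rwa [Set.indicator_of_mem ha] at h

theorem add_mass_le_one (hp : IsLottery p) {S : Set A} {b : A} (hb : b ∉ S) :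
    p b + mass p S ≤ 1 := by
  have h : mass p S + mass p {b} ≤ 1 := by
    rw [← hp.2, mass, mass, ← Finset.sum_add_distrib]
    refine Finset.sum_le_sum fun x _ => ?_
    have := hp.1 x
    by_cases hx : x = b
    · subst hx
      simp [hb]
    · by_cases hS : x ∈ S <;> simp [hx, hS, this]
  have hm : p b ≤ mass p {b} := hp.le_mass rfl
  linarith

end IsLottery

section SDdom

variable {A : Type*} [Fintype A] {r : A → A → Prop} {p q : A → ℝ}

theorem SDdom.le_of_topRanked (h : SDdom r p q) (hr : IsPref r) {a : A} (ha : TopRanked r a) :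
    q a ≤ p a := by
  have hUC : UC r a = {a} := by
    ext x
    refine ⟨fun hx => hx.elim (fun hx => ?_) id, Or.inr⟩
    by_contra hne
    exact hr.2.2 _ _ hx (ha x hne)
  simpa [mass, hUC, Set.indicator_apply] using h a

theorem SDdom.eq_zero_of_right (h : SDdom r p q) (hr : IsPref r) (hp : IsLottery p)
    (hq : IsLottery q) {a b : A} (ha : q a = 1) (hab : r a b) : p b = 0 := by
  have hb : b ∉ UC r a := by
    rintro (hb | rfl)
    · exact hr.2.2 _ _ hab hb
    · exact hr.irrefl _ hab
  have h1 := hp.add_mass_le_one hb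
  have h2 : q a ≤ mass q (UC r a) := hq.le_mass (Or.inr rfl)
  have h3 := h a
  have h4 := hp.1 b
  linarith

theorem SDdom.eq_zero_of_left (h : SDdom r p q) (hr : IsPref r) (hp : IsLottery p)
    (hq : IsLottery q) {a b : A} (ha : p a = 1) (hba : r b a) : q b = 0 := by
  have hb : a ∉ UC r b := by
    rintro (hb | rfl)
    · exact hr.2.2 _ _ hba hb
    · exact hr.irrefl _ hba
  have h1 := hp.add_mass_le_one hb
  have h2 : q b ≤ mass q (UC r b) := hq.le_mass (Or.inr rfl)
  have h3 := h b
  have h4 := hq.1 b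
  linarith

theorem SDdom.eq_one_of_bottom (h : SDdom r p q) (hr : IsPref r) (hp : IsLottery p)
    (hq : IsLottery q) {a : A} (ha : p a = 1) (hbot : ∀ x, x ≠ a → r x a) : q a = 1 :=
  hq.eq_one_of_forall fun x hx => h.eq_zero_of_left hr hp hq ha (hbot x hx)

theorem SDdom.eq_one_of_topRanked (h : SDdom r p q) (hr : IsPref r) (hp : IsLottery p)
    {a : A} (ha : TopRanked r a) (hq : q a = 1) : p a = 1 :=
  le_antisymm (hp.le_one a) (hq ▸ h.le_of_topRanked hr ha)

theorem sdDom_of_topRanked (hp : IsLottery p) (hq : IsLottery q) {a : A} (ha : TopRanked r a)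
    (h : p a = 1) : SDdom r p q := fun x => by
  have hx : a ∈ UC r x := by
    by_cases hxa : x = a
    · exact Or.inr hxa.symm
    · exact Or.inl (ha x hxa)
  have := hp.le_mass hx
  have := hq.mass_le_one (UC r x)
  linarith

end SDdom

/-- A two-agent social decision scheme on the full domain that neither agent can manipulate and
under which no alternative `a` is preferred by both agents to part of the outcome. -/
structure IsTwoAgentScheme {A : Type*} [Fintype A]
    (g : (A → A → Prop) → (A → A → Prop) → A → ℝ) : Prop where
  lottery : ∀ s t, IsPref s → IsPref t → IsLottery (g s t)
  left : ∀ s s' t, IsPref s → IsPref s' → IsPref t → SDdom s (g s t) (g s' t)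
  right : ∀ s t t', IsPref s → IsPref t → IsPref t' → SDdom t (g s t) (g s t')
  support : ∀ s t, IsPref s → IsPref t → ∀ a,
    (∀ b, s a b → g s t b = 0) ∨ (∀ b, t a b → g s t b = 0)

namespace IsTwoAgentScheme

variable {A : Type*} [Fintype A] {g : (A → A → Prop) → (A → A → Prop) → A → ℝ}

theorem flip (hg : IsTwoAgentScheme g) : IsTwoAgentScheme fun s t => g t s where
  lottery s t hs ht := hg.lottery t s ht hs
  left s s' t hs hs' ht := hg.right t s s' ht hs hs'
  right s t t' hs ht ht' := hg.left t t' s ht ht' hs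
  support s t hs ht a := (hg.support t s ht hs a).symm

theorem pareto (hg : IsTwoAgentScheme g) {s t : A → A → Prop} (hs : IsPref s) (ht : IsPref t)
    {a b : A} (hsab : s a b) (htab : t a b) : g s t b = 0 :=
  (hg.support s t hs ht a).elim (fun h => h b hsab) (fun h => h b htab)

theorem left_top_le (hg : IsTwoAgentScheme g) {s s' t : A → A → Prop} (hs : IsPref s)
    (hs' : IsPref s') (ht : IsPref t) {a : A} (ha : TopRanked s a) : g s' t a ≤ g s t a :=
  (hg.left s s' t hs hs' ht).le_of_topRanked hs ha

theorem eq_one_of_eq_zero (hg : IsTwoAgentScheme g) {y z w : A} (hyz : y ≠ z) (hwy : w ≠ y)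
    (hwz : w ≠ z) {s t : A → A → Prop} (hs : IsPref s) (ht : IsPref t) (hsy : TopRanked s y)
    (htz : TopRanked t z) (h0 : g s t z = 0) : g s t y = 1 := by
  obtain ⟨s', hs', hs'y, hs'z, -⟩ := exists_ranked_pref hyz hwy.symm hwz.symm
  obtain ⟨t', ht', ht'z, ht'y, -⟩ := exists_ranked_pref hyz.symm hwz.symm hwy.symm
  have supp₁ : ∀ x, x ≠ y → x ≠ z → g s t' x = 0 := fun x hxy hxz =>
    hg.pareto hs ht' (hsy x hxy) (ht'y x hxz hxy)
  have supp₂ : ∀ x, x ≠ y → x ≠ z → g s' t x = 0 := fun x hxy hxz =>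
    hg.pareto hs' ht (hs'z x hxy hxz) (htz x hxz)
  have h₁ : g s t' z = 0 := le_antisymm
    (h0 ▸ hg.flip.left_top_le ht ht' hs htz) ((hg.lottery s t' hs ht').1 z)
  have h₂ : g s t' y = 1 := (hg.lottery s t' hs ht').eq_one_of_forall fun x hx => by
    by_cases hxz : x = z
    · rw [hxz, h₁]
    · exact supp₁ x hx hxz
  have h₃ : g s' t' y = 1 :=
    (hg.left s' s t' hs' hs ht').eq_one_of_topRanked hs' (hg.lottery s' t' hs' ht') hs'y h₂
  have h₄ : g s' t' z = 0 := (hg.lottery s' t' hs' ht').eq_zero_of_eq_one h₃ hyz.symm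
  have h₅ : g s' t z = 0 := le_antisymm
    (h₄ ▸ hg.flip.left_top_le ht' ht hs' ht'z) ((hg.lottery s' t hs' ht).1 z)
  have h₆ : g s' t y = 1 := (hg.lottery s' t hs' ht).eq_one_of_forall fun x hx => by
    by_cases hxz : x = z
    · rw [hxz, h₅]
    · exact supp₂ x hx hxz
  exact (hg.left s s' t hs hs' ht).eq_one_of_topRanked hs (hg.lottery s t hs ht) hsy h₆

theorem deterministic (hg : IsTwoAgentScheme g) {y z w : A} (hyz : y ≠ z) (hwy : w ≠ y)
    (hwz : w ≠ z) {s t : A → A → Prop} (hs : IsPref s) (ht : IsPref t) (hsy : TopRanked s y)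
    (htz : TopRanked t z) (hsw : s w z) (htw : t w y) : g s t y = 1 ∨ g s t z = 1 :=
  (hg.support s t hs ht w).imp
    (fun h => hg.eq_one_of_eq_zero hyz hwy hwz hs ht hsy htz (h z hsw))
    (fun h => hg.flip.eq_one_of_eq_zero hyz.symm hwz hwy ht hs htz hsy (h y htw))

theorem right_forces_of_not_left (hg : IsTwoAgentScheme g) {y b c : A} (hyb : y ≠ b) (hcy : c ≠ y)
    (hcb : c ≠ b)
    (hy : ∀ s t, IsPref s → IsPref t → TopRanked s y → (∀ x, x ≠ y → t x y) → g s t y ≠ 1)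
    {t : A → A → Prop} (ht : IsPref t) (htb : TopRanked t b) (hty : ∀ x, x ≠ y → t x y)
    {s : A → A → Prop} (hs : IsPref s) : g s t b = 1 := by
  obtain ⟨s₀, hs₀, hs₀y, -, hs₀b⟩ := exists_ranked_pref hcy.symm hyb hcb
  have h := (hg.deterministic hyb hcy hcb hs₀ ht hs₀y htb (hs₀b c hcb) (hty c hcy)).resolve_left
    (hy s₀ t hs₀ ht hs₀y hty)
  exact (hg.left s₀ s t hs₀ hs ht).eq_one_of_bottom hs₀ (hg.lottery s₀ t hs₀ ht)
    (hg.lottery s t hs ht) h hs₀b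

theorem left_or_right (hg : IsTwoAgentScheme g) (hA : 3 ≤ Fintype.card A) (y z : A) :
    (∃ s t, IsPref s ∧ IsPref t ∧ TopRanked s y ∧ (∀ x, x ≠ y → t x y) ∧ g s t y = 1) ∨
    (∃ s t, IsPref s ∧ IsPref t ∧ TopRanked t z ∧ (∀ x, x ≠ z → s x z) ∧ g s t z = 1) := by
  by_contra! h
  obtain ⟨hy, hz⟩ := h
  by_cases hyz : y = z
  · subst hyz
    obtain ⟨b, hb, -⟩ := exists_third hA y y
    obtain ⟨c, hcy, hcb⟩ := exists_third hA y b
    obtain ⟨r, hr, hrb, -, hry⟩ := exists_ranked_pref hcb.symm hb hcy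
    obtain ⟨r', hr', hr'c, -, hr'y⟩ := exists_ranked_pref hcb hcy hb
    have h₁ : g r' r b = 1 := hg.right_forces_of_not_left hb.symm hcy hcb hy hr hrb hry hr'
    have h₂ : g r' r c = 1 := hg.flip.right_forces_of_not_left hcy.symm hb hcb.symm
      (fun s t hs ht => hz t s ht hs) hr' hr'c hr'y hr
    have h₃ := (hg.lottery r' r hr' hr).eq_zero_of_eq_one h₁ hcb
    linarith
  · obtain ⟨w, hwy, hwz⟩ := exists_third hA y z
    obtain ⟨s, hs, hsy, -, hsz⟩ := exists_ranked_pref hwy.symm hyz hwz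
    obtain ⟨t, ht, htz, -, hty⟩ := exists_ranked_pref hwz.symm (Ne.symm hyz) hwy
    exact (hg.deterministic hyz hwy hwz hs ht hsy htz (hsz w hwz) (hty w hwy)).elim
      (hy s t hs ht hsy hty) (hz s t hs ht htz hsz)

end IsTwoAgentScheme

theorem IsProf.piecewise {n : ℕ} {A : Type*} {R R' : Prof n A} (hR : IsProf R) (hR' : IsProf R')
    (S : Finset (Fin n)) : IsProf (S.piecewise R R') := fun i => by
  by_cases hi : i ∈ S
  · simpa [hi] using hR i
  · simpa [hi] using hR' i

theorem mem_condorcetDomain_of_majority {n : ℕ} {A : Type*} {R : Prof n A} (hR : IsProf R)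
    {S : Finset (Fin n)} (hS : n < 2 * S.card) {x : A} (hx : ∀ i ∈ S, TopRanked (R i) x) :
    R ∈ CondorcetDomain n A := by
  refine ⟨hR, x, fun y hy => ?_⟩
  have h₁ : S.card ≤ Nat.card {i : Fin n // R i x y} := by
    rw [Nat.card_eq_fintype_card, Fintype.card_subtype]
    exact Finset.card_le_card fun i hi => by simpa using hx i hi y hy
  have h₂ : Nat.card {i : Fin n // R i y x} ≤ Sᶜ.card := by
    rw [Nat.card_eq_fintype_card, Fintype.card_subtype]
    refine Finset.card_le_card fun i hi => ?_
    simp only [Finset.mem_filter, Finset.mem_univ, true_and] at hi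
    exact Finset.mem_compl.2 fun hiS => (hR i).2.2 _ _ hi (hx i hiS y hy)
  rw [Finset.card_compl, Fintype.card_fin] at h₂
  unfold margin
  omega

/-- The voters in `S` can enforce every alternative by unanimously top-ranking it. -/
def Decisive {n : ℕ} {A : Type*} (D : Set (Prof n A)) (f : Prof n A → A → ℝ)
    (S : Finset (Fin n)) : Prop :=
  ∀ R ∈ D, ∀ z, (∀ i ∈ S, TopRanked (R i) z) → f R z = 1

section Decisive

variable {n : ℕ} {A : Type*} [Fintype A] {D : Set (Prof n A)} {f : Prof n A → A → ℝ}

theorem GroupStrategyproof.decisive_univ (hn : 3 ≤ n) (hDprof : ∀ R ∈ D, IsProf R)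
    (hf : IsSDS D f) (hG : GroupStrategyproof D f) (hNI : NonImposing D f) :
    Decisive D f Finset.univ := by
  intro R hR z hz
  obtain ⟨R', hR', h1⟩ := hNI z
  have : NeZero n := ⟨by omega⟩
  obtain ⟨i, -, hi⟩ := hG R hR R' hR' Finset.univ Finset.univ_nonempty (by simp)
  exact hi.eq_one_of_topRanked (hDprof R hR i) (hf R hR) (hz i (Finset.mem_univ i)) h1

theorem Decisive.nonempty [Nontrivial A] (hf : IsSDS D f) (hne : D.Nonempty)
    {S : Finset (Fin n)} (hS : Decisive D f S) : S.Nonempty := by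
  by_contra h
  rw [Finset.not_nonempty_iff_eq_empty] at h
  obtain ⟨R, hR⟩ := hne
  obtain ⟨a, b, hab⟩ := exists_pair_ne A
  have h1 := hS R hR a (by simp [h])
  have h2 := hS R hR b (by simp [h])
  have h3 := IsLottery.eq_zero_of_eq_one (hf R hR) h1 hab.symm
  linarith

theorem Decisive.exists_support (hDprof : ∀ R ∈ D, IsProf R) (hf : IsSDS D f)
    (hG : GroupStrategyproof D f) {S : Finset (Fin n)} (hS : Decisive D f S)
    (hne : S.Nonempty) {R : Prof n A} (hR : R ∈ D) {r : A → A → Prop} {a : A}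
    (hra : TopRanked r a) (hR' : S.piecewise (fun _ => r) R ∈ D) :
    ∃ i ∈ S, ∀ b, R i a b → f R b = 0 := by
  obtain ⟨i, hi, h⟩ := hG R hR _ hR' S hne fun j hj => by simp [hj]
  refine ⟨i, hi, fun b hb => h.eq_zero_of_right (hDprof R hR i) (hf R hR) (hf _ hR') ?_ hb⟩
  exact hS _ hR' a fun j hj => by simpa [hj] using hra

theorem Decisive.eq_zero (hDprof : ∀ R ∈ D, IsProf R) (hf : IsSDS D f)
    (hG : GroupStrategyproof D f) {S : Finset (Fin n)} (hS : Decisive D f S)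
    (hne : S.Nonempty) {R : Prof n A} (hR : R ∈ D) {r : A → A → Prop} {a b : A}
    (hra : TopRanked r a) (hR' : S.piecewise (fun _ => r) R ∈ D) (hab : ∀ i ∈ S, R i a b) :
    f R b = 0 := by
  obtain ⟨i, hi, h⟩ := hS.exists_support hDprof hf hG hne hR hra hR'
  exact h b (hab i hi)

theorem GroupStrategyproof.isTwoAgentScheme (hDprof : ∀ R ∈ D, IsProf R) (hf : IsSDS D f)
    (hA : 3 ≤ Fintype.card A)
    (hG : GroupStrategyproof D f) (hU : Decisive D f Finset.univ) {S : Finset (Fin n)}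
    (hS : S.Nonempty) (hSc : Sᶜ.Nonempty)
    (hD : ∀ s t, IsPref s → IsPref t → S.piecewise (fun _ => s) (fun _ => t) ∈ D) :
    IsTwoAgentScheme fun s t => f (S.piecewise (fun _ => s) (fun _ => t)) where
  lottery s t hs ht := hf _ (hD s t hs ht)
  left s s' t hs hs' ht := by
    obtain ⟨i, hi, h⟩ := hG _ (hD s t hs ht) _ (hD s' t hs' ht) S hS fun j hj => by simp [hj]
    simpa [hi] using h
  right s t t' hs ht ht' := by
    obtain ⟨i, hi, h⟩ := hG _ (hD s t hs ht) _ (hD s t' hs ht') Sᶜ hSc fun j hj => by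
      simp only [Finset.mem_compl, not_not] at hj
      simp [hj]
    simpa [Finset.mem_compl.1 hi] using h
  support s t hs ht a := by
    obtain ⟨r, hr, hra⟩ := exists_pref_topRanked hA a
    have hR' : Finset.univ.piecewise (fun _ => r) (S.piecewise (fun _ => s) fun _ => t) ∈ D := by
      have h := hD r r hr hr
      rw [show S.piecewise (fun _ => r) (fun _ => r) = fun _ => r from
        funext fun i => ite_self r] at h
      simpa using h
    obtain ⟨i, -, h⟩ := hU.exists_support hDprof hf hG (hS.mono (Finset.subset_univ S))
      (hD s t hs ht) hra hR'
    by_cases hi : i ∈ S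
    · exact Or.inl (by simpa [hi] using h)
    · exact Or.inr (by simpa [hi] using h)

theorem GroupStrategyproof.eq_one_of_opposed (hDprof : ∀ R ∈ D, IsProf R) (hf : IsSDS D f)
    (hG : GroupStrategyproof D f) {S : Finset (Fin n)}
    (hS : S.Nonempty) (hSc : Sᶜ.Nonempty) {s t : A → A → Prop} {z : A}
    (htz : ∀ x, x ≠ z → t x z)
    (hst : S.piecewise (fun _ => s) (fun _ => t) ∈ D)
    (h1 : f (S.piecewise (fun _ => s) (fun _ => t)) z = 1) {R : Prof n A} (hR : R ∈ D)
    (hRz : ∀ i ∈ S, TopRanked (R i) z) (hRt : S.piecewise R (fun _ => t) ∈ D) : f R z = 1 := by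
  have h2 : f (S.piecewise R (fun _ => t)) z = 1 := by
    obtain ⟨i, hi, h⟩ := hG _ hRt _ hst S hS fun j hj => by simp [hj]
    refine h.eq_one_of_topRanked (hDprof _ hRt i) (hf _ hRt) ?_ h1
    simpa [hi] using hRz i hi
  obtain ⟨i, hi, h⟩ := hG _ hRt R hR Sᶜ hSc fun j hj => by
    simp only [Finset.mem_compl, not_not] at hj
    simp [hj]
  refine h.eq_one_of_bottom (hDprof _ hRt i) (hf _ hRt) (hf R hR) h2 ?_
  simpa [Finset.mem_compl.1 hi] using htz

theorem GroupStrategyproof.decisive_or_decisive_compl (hA : 3 ≤ Fintype.card A)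
    (hDprof : ∀ R ∈ D, IsProf R) (hDC : CondorcetDomain n A ⊆ D) (hf : IsSDS D f)
    (hG : GroupStrategyproof D f) (hU : Decisive D f Finset.univ) {S : Finset (Fin n)}
    (hS : n < 2 * S.card) : Decisive D f S ∨ Decisive D f Sᶜ := by
  rcases Sᶜ.eq_empty_or_nonempty with hSc | hSc
  · exact Or.inl (by rwa [(Finset.compl_eq_empty_iff S).1 hSc])
  have hSne : S.Nonempty := Finset.card_pos.1 (by omega)
  have : Nonempty A := Fintype.card_pos_iff.1 (by omega)
  have hD : ∀ (s : A → A → Prop) (R : Prof n A), IsPref s → IsProf R →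
      S.piecewise (fun _ => s) R ∈ D := fun s R hs hR => by
    obtain ⟨a, ha⟩ := hs.exists_topRanked
    exact hDC (mem_condorcetDomain_of_majority (IsProf.piecewise (fun _ => hs) hR S) hS
      fun i hi => by simpa [hi] using ha)
  have hg := hG.isTwoAgentScheme hDprof hf hA hU hSne hSc fun s t hs ht => hD s _ hs fun _ => ht
  by_contra! h
  obtain ⟨h₁, h₂⟩ := h
  unfold Decisive at h₁ h₂
  push Not at h₁ h₂
  obtain ⟨R, hR, y, hRy, hfy⟩ := h₁
  obtain ⟨R', hR', z, hRz, hfz⟩ := h₂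
  rcases hg.left_or_right hA y z with ⟨s, t, hs, ht, hsy, hty, h1⟩ | ⟨s, t, hs, ht, htz, hsz, h1⟩
  · refine hfy (hG.eq_one_of_opposed hDprof hf hSne hSc hty (hD s _ hs fun _ => ht) h1 hR hRy ?_)
    exact hDC (mem_condorcetDomain_of_majority ((hDprof R hR).piecewise (fun _ => ht) S) hS
      fun i hi => by simpa [hi] using hRy i hi)
  · refine hfz (hG.eq_one_of_opposed (s := t) hDprof hf hSc (by simpa using hSne) hsz ?_ ?_ hR'
      hRz ?_)
    · rw [Finset.piecewise_compl]
      exact hD s _ hs fun _ => ht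
    · rw [Finset.piecewise_compl]
      exact h1
    · rw [Finset.piecewise_compl]
      exact hD s R' hs (hDprof R' hR')

theorem GroupStrategyproof.not_decisive_union (hA : 3 ≤ Fintype.card A)
    (hDprof : ∀ R ∈ D, IsProf R) (hDC : CondorcetDomain n A ⊆ D) (hf : IsSDS D f)
    (hG : GroupStrategyproof D f) {S T : Finset (Fin n)} (hdisj : Disjoint S T)
    (hcard : 2 * (S ∪ T).card < n) (hS : Decisive D f Sᶜ) (hT : Decisive D f Tᶜ)
    (hne : (S ∪ T).Nonempty) :
    ¬ Decisive D f (S ∪ T) := by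
  intro hST
  have : Nonempty A := Fintype.card_pos_iff.1 (by omega)
  obtain ⟨x⟩ := this
  obtain ⟨y, hyx, -⟩ := exists_third hA x x
  obtain ⟨z, hzx, hzy⟩ := exists_third hA x y
  obtain ⟨k, hk, hkx, hky, -⟩ := exists_ranked_pref hyx.symm hzx.symm hzy.symm
  obtain ⟨s, hs, hsz, hsx, -⟩ := exists_ranked_pref hzx hzy hyx.symm
  obtain ⟨t, ht, hty, -, htx⟩ := exists_ranked_pref hzy.symm hyx hzx
  obtain ⟨rz, hrz, hrzz⟩ := exists_pref_topRanked hA z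
  let R : Prof n A := S.piecewise (fun _ => s) (T.piecewise (fun _ => t) fun _ => k)
  have hRp : IsProf R := IsProf.piecewise (fun _ => hs)
    (IsProf.piecewise (fun _ => ht) (fun _ => hk) T) S
  have hRS : ∀ i ∈ S, R i = s := fun i hi => by simp [R, hi]
  have hRT : ∀ i ∈ T, R i = t := fun i hi => by
    simp [R, hi, Finset.disjoint_right.1 hdisj hi]
  have hRK : ∀ i, i ∉ S → i ∉ T → R i = k := fun i hi hi' => by simp [R, hi, hi']
  have hcu := Finset.card_union_of_disjoint hdisj
  have hcS := Finset.card_compl S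
  have hcT := Finset.card_compl T
  have hcST := Finset.card_compl (S ∪ T)
  rw [Fintype.card_fin] at hcS hcT hcST
  have hmem : ∀ (a : A) (U : Finset (Fin n)), n < 2 * U.card → ∀ R' : Prof n A, IsProf R' →
      (∀ i ∈ U, TopRanked (R' i) a) → R' ∈ D := fun a U hU R' hR' ha =>
    hDC (mem_condorcetDomain_of_majority hR' hU ha)
  have hRD : R ∈ D := hmem x (S ∪ T)ᶜ (by omega) R hRp fun i hi => by
    simp only [Finset.mem_compl, Finset.mem_union, not_or] at hi
    rwa [hRK i hi.1 hi.2]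
  have hx : f R x = 0 := by
    refine hST.eq_zero hDprof hf hG hne hRD hrzz (hmem x (S ∪ T)ᶜ (by omega) _
      (IsProf.piecewise (fun _ => hrz) hRp _) fun i hi => ?_) fun i hi => ?_
    · rw [Finset.piecewise_eq_of_notMem _ _ _ (Finset.mem_compl.1 hi)]
      simp only [Finset.mem_compl, Finset.mem_union, not_or] at hi
      rwa [hRK i hi.1 hi.2]
    · rcases Finset.mem_union.1 hi with hi | hi
      · rw [hRS i hi]
        exact hsz x hzx.symm
      · rw [hRT i hi]
        exact htx z hzx
  have hz : f R z = 0 := by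
    refine hS.eq_zero hDprof hf hG (Finset.card_pos.1 (by omega)) hRD hty (hmem y Sᶜ (by omega) _
      (IsProf.piecewise (fun _ => ht) hRp _) fun i hi => ?_) fun i hi => ?_
    · rwa [Finset.piecewise_eq_of_mem _ _ _ hi]
    · rw [Finset.mem_compl] at hi
      by_cases hi' : i ∈ T
      · rw [hRT i hi']
        exact hty z hzy
      · rw [hRK i hi hi']
        exact hky z hzx hzy
  have hother : ∀ b, b ≠ x → b ≠ z → f R b = 0 := by
    intro b hbx hbz
    refine hT.eq_zero hDprof hf hG (Finset.card_pos.1 (by omega)) hRD hkx (hmem x Tᶜ (by omega) _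
      (IsProf.piecewise (fun _ => hk) hRp _) fun i hi => ?_) fun i hi => ?_
    · rwa [Finset.piecewise_eq_of_mem _ _ _ hi]
    · rw [Finset.mem_compl] at hi
      by_cases hi' : i ∈ S
      · rw [hRS i hi']
        exact hsx b hbz hbx
      · rw [hRK i hi' hi]
        exact hkx b hbx
  have hx1 : f R x = 1 := IsLottery.eq_one_of_forall (hf R hRD) fun b hbx => by
    by_cases hbz : b = z
    · rw [hbz, hz]
    · exact hother b hbx hbz
  linarith

theorem GroupStrategyproof.exists_decisive_singleton (hn : 3 ≤ n) (hA : 3 ≤ Fintype.card A)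
    (hDprof : ∀ R ∈ D, IsProf R) (hDC : CondorcetDomain n A ⊆ D) (hf : IsSDS D f)
    (hG : GroupStrategyproof D f) (hU : Decisive D f Finset.univ) (hne : D.Nonempty)
    (J : Finset (Fin n)) (hcard : 2 * J.card < n) (hJ : Decisive D f J) :
    ∃ j, Decisive D f {j} := by
  have : Nontrivial A := Fintype.one_lt_card_iff_nontrivial.1 (by omega)
  induction J using Finset.induction_on with
  | empty => exact absurd (hJ.nonempty hf hne) Finset.not_nonempty_empty
  | insert j J hj ih =>
    rw [Finset.card_insert_of_notMem hj] at hcard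
    by_cases hJ' : Decisive D f J
    · exact ih (by omega) hJ'
    by_contra! hsing
    have hcomp : ∀ T : Finset (Fin n), 2 * T.card < n → ¬ Decisive D f T → Decisive D f Tᶜ := by
      intro T hT hTd
      have hc := Finset.card_compl T
      rw [Fintype.card_fin] at hc
      have := hG.decisive_or_decisive_compl hA hDprof hDC hf hU (S := Tᶜ) (by omega)
      rw [compl_compl] at this
      exact this.resolve_right hTd
    rw [Finset.insert_eq] at hJ
    refine hG.not_decisive_union hA hDprof hDC hf (Finset.disjoint_singleton_left.2 hj) ?_
      (hcomp {j} ?_ (hsing j)) (hcomp J (by omega) hJ') ⟨j, by simp⟩ hJ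
    · rw [← Finset.insert_eq, Finset.card_insert_of_notMem hj]
      omega
    · rw [Finset.card_singleton]
      omega

theorem GroupStrategyproof.not_forall_majority_decisive (hA : 3 ≤ Fintype.card A)
    (hDprof : ∀ R ∈ D, IsProf R) (hDC : CondorcetDomain n A ⊆ D) (hf : IsSDS D f)
    (hG : GroupStrategyproof D f) (hRstar : ∃ R ∈ D, ∀ x : A, ∃ y : A, 0 < margin R y x) :
    ∃ S : Finset (Fin n), n < 2 * S.card ∧ ¬ Decisive D f S := by
  by_contra! hmaj
  obtain ⟨R, hR, hcyc⟩ := hRstar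
  obtain ⟨x, hx⟩ : ∃ x, f R x ≠ 0 := by
    by_contra! h
    simpa [h] using (hf R hR).2
  obtain ⟨y, hy⟩ := hcyc x
  have hxy : y ≠ x := by
    rintro rfl
    simp [margin] at hy
  let S : Finset (Fin n) := Finset.univ.filter fun i => R i y x
  have hSc : Sᶜ.card ≤ Nat.card {i : Fin n // R i x y} := by
    rw [Nat.card_eq_fintype_card, Fintype.card_subtype]
    refine Finset.card_le_card fun i hi => ?_
    have hi' : ¬ R i y x := by simpa [S] using hi
    simpa using (hDprof R hR i).1 y x hxy |>.resolve_left hi'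
  have hS : Nat.card {i : Fin n // R i y x} = S.card := by
    rw [Nat.card_eq_fintype_card, Fintype.card_subtype]
  have hcompl := Finset.card_compl S
  have hle := Finset.card_le_univ S
  rw [Fintype.card_fin] at hcompl hle
  unfold margin at hy
  have hmajS : n < 2 * S.card := by omega
  obtain ⟨r, hr, hry⟩ := exists_pref_topRanked hA y
  refine hx ((hmaj S hmajS).eq_zero hDprof hf hG (Finset.card_pos.1 (by omega)) hR hry ?_
    fun i hi => by simpa [S] using hi)
  exact hDC (mem_condorcetDomain_of_majority (IsProf.piecewise (fun _ => hr) (hDprof R hR) S) hmajS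
    fun i hi => by simpa [hi] using hry)

end Decisive

theorem dict_eq_one {n : ℕ} {A : Type*} [Fintype A] {i : Fin n} {R : Prof n A} {a : A}
    (ha : TopRanked (R i) a) : dict i R a = 1 := if_pos ha

theorem groupStrategyproof_of_dict {n : ℕ} {A : Type*} [Fintype A] [Nonempty A]
    {D : Set (Prof n A)} (hDprof : ∀ R ∈ D, IsProf R) {f : Prof n A → A → ℝ} (hf : IsSDS D f)
    {i : Fin n} (hi : ∀ R ∈ D, ∀ x, f R x = dict i R x) : GroupStrategyproof D f := by
  intro R hR R' hR' I hI hout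
  by_cases hiI : i ∈ I
  · obtain ⟨a, ha⟩ := (hDprof R hR i).exists_topRanked
    exact ⟨i, hiI, sdDom_of_topRanked (hf R hR) (hf R' hR') ha
      ((hi R hR a).trans (dict_eq_one ha))⟩
  · obtain ⟨j, hj⟩ := hI
    have : f R = f R' := by
      ext x
      rw [hi R hR, hi R' hR', dict, dict, hout i hiI]
    exact ⟨j, hj, fun x => by rw [this]⟩

theorem nonImposing_of_dict {n : ℕ} {A : Type*} [Fintype A] (hA : 3 ≤ Fintype.card A)
    {D : Set (Prof n A)} (hDC : CondorcetDomain n A ⊆ D) {f : Prof n A → A → ℝ}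
    {i : Fin n} (hi : ∀ R ∈ D, ∀ x, f R x = dict i R x) : NonImposing D f := by
  intro x
  obtain ⟨r, hr, hrx⟩ := exists_pref_topRanked hA x
  have hpos : 0 < n := i.pos
  have hD : (fun _ => r : Prof n A) ∈ D := hDC (mem_condorcetDomain_of_majority (fun _ => hr)
    (S := Finset.univ) (by simp; omega) fun _ _ => hrx)
  exact ⟨_, hD, (hi _ hD x).trans (dict_eq_one hrx)⟩

theorem Decisive.eq_dict {n : ℕ} {A : Type*} [Fintype A] [Nonempty A]
    {D : Set (Prof n A)} (hDprof : ∀ R ∈ D, IsProf R) {f : Prof n A → A → ℝ} (hf : IsSDS D f)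
    {i : Fin n} (hi : Decisive D f {i}) {R : Prof n A} (hR : R ∈ D) (x : A) :
    f R x = dict i R x := by
  obtain ⟨a, ha⟩ := (hDprof R hR i).exists_topRanked
  have h1 : f R a = 1 := hi R hR a (by simpa using ha)
  by_cases hx : x = a
  · rw [hx, h1, dict_eq_one ha]
  · rw [IsLottery.eq_zero_of_eq_one (hf R hR) h1 hx, dict, if_neg]
    exact fun h => (hDprof R hR i).2.2 _ _ (ha x hx) (h a (Ne.symm hx))

/-- For `n ≥ 3` and a domain `D ⊋ D_C` containing a profile without a weak
Condorcet winner, an SDS on `D` is group-strategyproof and non-imposing iff it is a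
dictatorship. -/
theorem groupStrategyproof_superCondorcet_dictatorship {n : ℕ} {A : Type*} [Fintype A]
    (hn : 3 ≤ n) (hA : 3 ≤ Fintype.card A)
    (D : Set (Prof n A)) (hDprof : ∀ R ∈ D, IsProf R)
    (hDC : CondorcetDomain n A ⊂ D)
    (hRstar : ∃ R ∈ D, ∀ x : A, ∃ y : A, 0 < margin R y x)
    (f : Prof n A → A → ℝ) (hf : IsSDS D f) :
    (GroupStrategyproof D f ∧ NonImposing D f) ↔
      (∃ i : Fin n, ∀ R ∈ D, ∀ x, f R x = dict i R x) := by
  have : Nonempty A := Fintype.card_pos_iff.1 (by omega)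
  constructor
  · rintro ⟨hG, hNI⟩
    have hU := hG.decisive_univ hn hDprof hf hNI
    obtain ⟨S, hS, hSd⟩ := hG.not_forall_majority_decisive hA hDprof hDC.1 hf hRstar
    have hSc := (hG.decisive_or_decisive_compl hA hDprof hDC.1 hf hU hS).resolve_left hSd
    have hcard := Finset.card_compl S
    rw [Fintype.card_fin] at hcard
    obtain ⟨R, hR, -⟩ := hRstar
    obtain ⟨i, hi⟩ := hG.exists_decisive_singleton hn hA hDprof hDC.1 hf hU ⟨R, hR⟩ Sᶜ
      (by omega) hSc
    exact ⟨i, fun R hR x => hi.eq_dict hDprof hf hR x⟩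
  · rintro ⟨i, hi⟩
    exact ⟨groupStrategyproof_of_dict hDprof hf hi, nonImposing_of_dict hA hDC.1 hi⟩
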